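/- arXiv:2603.28782 — 3 statements merged into one kernel-verified Lean document; each statement's English description precedes it below -/
import Mathlib

section
/- Let β ∈ [0,1], let f ∈ 𝒜_β with Taylor coefficients a_n, and let 0 < r < 1. Then the normalized area functional satisfies S_r/π = Σ_{n≥1} n|a_n|² r^{2n} ≤ r² + Σ_{n≥2} (4n/(n−β(n−1))²) r^{2n}. -/
open Metric Filter Set

/-- The class `𝒜_β`: analytic `f(z) = z + ∑_{n≥2} aₙ zⁿ` on the unit disk with
`Re (β f(z)/z + (1-β) f'(z)) > 0`. -/
def IsAbeta (β : ℝ) (a : ℕ → ℂ) (f : ℂ → ℂ) : Prop :=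
  a 0 = 0 ∧ a 1 = 1 ∧
  (∀ z ∈ Metric.ball (0 : ℂ) 1, HasSum (fun n => a n * z ^ n) (f z)) ∧
  ∀ z ∈ Metric.ball (0 : ℂ) 1, z ≠ 0 →
    0 < ((β : ℂ) * f z / z + (1 - (β : ℂ)) * deriv f z).re

/-- The Fourier coefficients of a power series on a circle, in terms of its coefficients. -/
lemma hasSum_integral_powerSeries_mul_exp {c : ℕ → ℂ} {P : ℂ → ℂ} {ρ : ℝ} (hρ : 0 ≤ ρ)
    (hs : Summable fun n => ‖c n‖ * ρ ^ n)
    (hP : ∀ θ : ℝ, HasSum (fun n => c n * circleMap 0 ρ θ ^ n) (P (circleMap 0 ρ θ))) (k : ℤ) :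
    HasSum (fun n : ℕ => if (n : ℤ) = k then 2 * Real.pi * (c n * (ρ : ℂ) ^ n) else 0)
      (∫ θ in (0 : ℝ)..2 * Real.pi,
        P (circleMap 0 ρ θ) * Complex.exp (-(k * θ * Complex.I))) := by
  have key : ∀ n : ℕ, (∫ θ in (0 : ℝ)..2 * Real.pi,
      c n * circleMap 0 ρ θ ^ n * Complex.exp (-(k * θ * Complex.I)))
      = if (n : ℤ) = k then 2 * Real.pi * (c n * (ρ : ℂ) ^ n) else 0 := by
    intro n
    have e : ∀ θ : ℝ, c n * circleMap 0 ρ θ ^ n * Complex.exp (-(k * θ * Complex.I))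
        = c n * (ρ : ℂ) ^ n * Complex.exp ((((n : ℤ) - k : ℤ) * Complex.I) * θ) := by
      intro θ
      rw [circleMap_zero, mul_pow, ← Complex.exp_nat_mul, mul_assoc, mul_assoc, mul_assoc,
        ← Complex.exp_add]
      push_cast
      ring_nf
    simp_rw [e]
    rw [intervalIntegral.integral_const_mul]
    split_ifs with h
    · simp [h]
      ring
    · have h' : ((((n : ℤ) - k : ℤ) : ℂ) * Complex.I) ≠ 0 :=
        mul_ne_zero (Int.cast_ne_zero.2 (sub_ne_zero.2 h)) Complex.I_ne_zero
      have h1 : Complex.exp ((((n : ℤ) - k : ℤ) : ℂ) * Complex.I * ((2 * Real.pi : ℝ) : ℂ)) = 1 :=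
        Complex.exp_eq_one_iff.2 ⟨(n : ℤ) - k, by push_cast; ring⟩
      rw [integral_exp_mul_complex h', h1]
      simp
  simp_rw [← key]
  refine intervalIntegral.hasSum_integral_of_dominated_convergence
    (fun n _ => ‖c n‖ * ρ ^ n) (fun n => ?_) (fun n => ?_) ?_ ?_ ?_
  · exact Continuous.aestronglyMeasurable (by fun_prop)
  · refine Eventually.of_forall fun θ _ => le_of_eq ?_
    have : ‖Complex.exp (-(k * θ * Complex.I))‖ = 1 := by
      rw [Complex.norm_exp]; simp
    simp [norm_pow, this, abs_of_nonneg hρ]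
  · exact Eventually.of_forall fun _ _ => hs
  · exact intervalIntegrable_const
  · exact Eventually.of_forall fun θ _ => (hP θ).mul_right _

/-- **Carathéodory's coefficient inequality**, on a fixed circle. -/
lemma norm_coeff_mul_pow_le_of_re_nonneg {c : ℕ → ℂ} {P : ℂ → ℂ} {ρ : ℝ} (hρ : 0 < ρ)
    (hs : Summable fun n => ‖c n‖ * ρ ^ n)
    (hP : ∀ θ : ℝ, HasSum (fun n => c n * circleMap 0 ρ θ ^ n) (P (circleMap 0 ρ θ)))
    (hre : ∀ θ : ℝ, 0 ≤ (P (circleMap 0 ρ θ)).re) {m : ℕ} (hm : m ≠ 0) :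
    ‖c m‖ * ρ ^ m ≤ 2 * (c 0).re := by
  have hcont : Continuous fun θ : ℝ => P (circleMap 0 ρ θ) := by
    have : (fun θ : ℝ => P (circleMap 0 ρ θ)) = fun θ => ∑' n, c n * circleMap 0 ρ θ ^ n :=
      funext fun θ => (hP θ).tsum_eq.symm
    rw [this]
    refine continuous_tsum (fun n => by fun_prop) hs fun n θ => le_of_eq ?_
    simp [norm_pow, abs_of_pos hρ]
  have hI : ∀ k : ℤ, IntervalIntegrable
      (fun θ : ℝ => P (circleMap 0 ρ θ) * Complex.exp (-(k * θ * Complex.I)))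
      MeasureTheory.volume 0 (2 * Real.pi) :=
    fun k => (hcont.mul (by fun_prop)).intervalIntegrable _ _
  have coeff (k : ℤ) := hasSum_integral_powerSeries_mul_exp hρ.le hs hP k
  have hpos : (∫ θ in (0 : ℝ)..2 * Real.pi,
      P (circleMap 0 ρ θ) * Complex.exp (-((m : ℤ) * θ * Complex.I)))
      = 2 * Real.pi * (c m * (ρ : ℂ) ^ m) := by
    refine (coeff m).unique ?_
    convert hasSum_ite_eq m (2 * Real.pi * (c m * (ρ : ℂ) ^ m)) using 2 with n
    by_cases h : n = m <;> simp [h]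
  have hneg : (∫ θ in (0 : ℝ)..2 * Real.pi,
      P (circleMap 0 ρ θ) * Complex.exp (-(((-m : ℤ) : ℂ) * θ * Complex.I))) = 0 := by
    refine (coeff (-m)).unique ?_
    convert hasSum_zero using 2 with n
    rw [if_neg (by omega)]
  have hzero : (∫ θ in (0 : ℝ)..2 * Real.pi, P (circleMap 0 ρ θ)) = 2 * Real.pi * c 0 := by
    have h := coeff 0
    simp only [Int.cast_zero, zero_mul, neg_zero, Complex.exp_zero, mul_one] at h
    refine h.unique ?_
    convert hasSum_ite_eq 0 (2 * Real.pi * c 0) using 2 with n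
    by_cases h : n = 0 <;> simp [h]
  have hre0 : (∫ θ in (0 : ℝ)..2 * Real.pi, (P (circleMap 0 ρ θ)).re)
      = 2 * Real.pi * (c 0).re := by
    have h := Complex.reCLM.intervalIntegral_comp_comm
      (hcont.intervalIntegrable (μ := MeasureTheory.volume) 0 (2 * Real.pi))
    simp only [Complex.reCLM_apply] at h
    rw [h, hzero]
    simp
  have hconj : (∫ θ in (0 : ℝ)..2 * Real.pi,
      (starRingEnd ℂ) (P (circleMap 0 ρ θ)) * Complex.exp (-((m : ℤ) * θ * Complex.I))) = 0 := by
    have h := Complex.conjCLE.toContinuousLinearMap.intervalIntegral_comp_comm (hI (-m))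
    rw [hneg] at h
    simp only [ContinuousLinearEquiv.coe_coe, Complex.conjCLE_apply, map_zero] at h
    refine Eq.trans (intervalIntegral.integral_congr fun θ _ => ?_) h
    simp [← Complex.exp_conj]
  have hsum : (∫ θ in (0 : ℝ)..2 * Real.pi,
      (2 * (P (circleMap 0 ρ θ)).re : ℝ) * Complex.exp (-((m : ℤ) * θ * Complex.I)))
      = 2 * Real.pi * (c m * (ρ : ℂ) ^ m) := by
    have hc : Continuous fun θ : ℝ =>
        (starRingEnd ℂ) (P (circleMap 0 ρ θ)) * Complex.exp (-((m : ℤ) * θ * Complex.I)) :=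
      (Complex.continuous_conj.comp hcont).mul (by fun_prop)
    have h := intervalIntegral.integral_add (hI m)
      (hc.intervalIntegrable (μ := MeasureTheory.volume) 0 (2 * Real.pi))
    rw [hpos, hconj, add_zero] at h
    rw [← h]
    refine intervalIntegral.integral_congr fun θ _ => ?_
    simp only [← add_mul, Complex.add_conj]
  have hle : ‖2 * Real.pi * (c m * (ρ : ℂ) ^ m)‖
      ≤ ∫ θ in (0 : ℝ)..2 * Real.pi, 2 * (P (circleMap 0 ρ θ)).re := by
    rw [← hsum]
    refine intervalIntegral.norm_integral_le_of_norm_le (by positivity)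
      (Eventually.of_forall fun θ _ => le_of_eq ?_)
      ((continuous_const.mul (Complex.continuous_re.comp hcont)).intervalIntegrable _ _)
    have : ‖Complex.exp (-((m : ℤ) * θ * Complex.I))‖ = 1 := by
      rw [Complex.norm_exp]; simp
    rw [norm_mul, this, mul_one, Complex.norm_real, Real.norm_of_nonneg]
    exact mul_nonneg zero_le_two (hre θ)
  rw [intervalIntegral.integral_const_mul, hre0] at hle
  simp only [norm_mul, norm_pow, Complex.norm_real, Real.norm_of_nonneg hρ.le,
    Real.norm_of_nonneg Real.pi_pos.le, Complex.norm_ofNat] at hle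
  nlinarith [Real.pi_pos]

/-- **Carathéodory's coefficient inequality** for functions with nonnegative real part on the
punctured unit disk. -/
lemma norm_coeff_le_of_re_nonneg {c : ℕ → ℂ} {P : ℂ → ℂ}
    (hP : ∀ z ∈ ball (0 : ℂ) 1, z ≠ 0 → HasSum (fun n => c n * z ^ n) (P z))
    (hre : ∀ z ∈ ball (0 : ℂ) 1, z ≠ 0 → 0 ≤ (P z).re) {m : ℕ} (hm : m ≠ 0) :
    ‖c m‖ ≤ 2 * (c 0).re := by
  have h : ∀ ρ ∈ Ioo (0 : ℝ) 1, ‖c m‖ * ρ ^ m ≤ 2 * (c 0).re := by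
    intro ρ hρ
    have hmem : ∀ θ : ℝ, circleMap 0 ρ θ ∈ ball (0 : ℂ) 1 := fun θ => by
      simpa [abs_of_pos hρ.1] using hρ.2
    have hne : ∀ θ : ℝ, circleMap 0 ρ θ ≠ 0 := fun θ => circleMap_ne_center hρ.1.ne'
    refine norm_coeff_mul_pow_le_of_re_nonneg hρ.1 ?_ (fun θ => hP _ (hmem θ) (hne θ))
      (fun θ => hre _ (hmem θ) (hne θ)) hm
    simpa [norm_mul, norm_pow, abs_of_pos hρ.1] using (hP _ (hmem 0) (hne 0)).summable.norm
  have hlim : Tendsto (fun ρ : ℝ => ‖c m‖ * ρ ^ m) (nhdsWithin 1 (Iio 1)) (nhds ‖c m‖) := by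
    have : Continuous fun ρ : ℝ => ‖c m‖ * ρ ^ m := by fun_prop
    simpa using (this.tendsto 1).mono_left nhdsWithin_le_nhds
  exact le_of_tendsto hlim
    (Filter.mem_of_superset (Ioo_mem_nhdsLT zero_lt_one) h)

/-- Termwise differentiation of a power series on the unit disk. -/
lemma hasSum_deriv_of_hasSum_ball {a : ℕ → ℂ} {f : ℂ → ℂ}
    (hf : ∀ z ∈ ball (0 : ℂ) 1, HasSum (fun n => a n * z ^ n) (f z))
    {z : ℂ} (hz : z ∈ ball (0 : ℂ) 1) :
    HasSum (fun n : ℕ => ((n : ℂ) + 1) * a (n + 1) * z ^ n) (deriv f z) := by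
  obtain ⟨ρ, hzρ, hρ⟩ := exists_between (mem_ball_zero_iff.1 hz)
  have hρ0 : 0 < ρ := (norm_nonneg z).trans_lt hzρ
  have hs : Summable fun n => ‖a n‖ * ρ ^ n := by
    have := (hf (ρ : ℂ) (by simpa [abs_of_pos hρ0] using hρ)).summable.norm
    simpa [norm_mul, norm_pow, abs_of_pos hρ0] using this
  have h := Complex.hasSum_deriv_of_summable_norm (F := fun n w => a n * w ^ n) hs
    (fun n => by fun_prop) (isOpen_ball (x := (0 : ℂ)) (ε := ρ)) (fun n w hw => by
      rw [norm_mul, norm_pow]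
      gcongr
      exact (mem_ball_zero_iff.1 hw).le) (mem_ball_zero_iff.2 hzρ)
  have he : (fun w => ∑' n, a n * w ^ n) =ᶠ[nhds z] f := by
    filter_upwards [isOpen_ball.mem_nhds hz] with w hw using (hf w hw).tsum_eq
  rw [he.deriv_eq] at h
  rw [← hasSum_nat_add_iff' 1] at h
  convert! h using 1
  · ext n
    simp
    ring
  · simp

lemma IsAbeta.norm_coeff_le {β : ℝ} (hβ : β ∈ Icc (0 : ℝ) 1) {a : ℕ → ℂ} {f : ℂ → ℂ}
    (hf : IsAbeta β a f) (n : ℕ) :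
    ‖a (n + 2)‖ * (((n : ℝ) + 2) - β * ((n : ℝ) + 1)) ≤ 2 := by
  obtain ⟨h0, h1, hsum, hre⟩ := hf
  have hP : ∀ z ∈ ball (0 : ℂ) 1, z ≠ 0 →
      HasSum (fun n : ℕ => ((β : ℂ) + (1 - β) * (n + 1)) * a (n + 1) * z ^ n)
        ((β : ℂ) * f z / z + (1 - (β : ℂ)) * deriv f z) := by
    intro z hz hz0
    have hd := (hasSum_deriv_of_hasSum_ball hsum hz).mul_left (1 - (β : ℂ))
    have hq := (hsum z hz)
    rw [← hasSum_nat_add_iff' 1] at hq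
    have hq := (hq.mul_left (β : ℂ)).div_const z
    simp only [Finset.range_one, Finset.sum_singleton, h0, zero_mul, sub_zero] at hq
    convert! hq.add hd using 1
    ext n
    rw [pow_succ, ← mul_assoc (a (n + 1)), ← mul_assoc, mul_div_cancel_right₀ _ hz0]
    ring
  have h := norm_coeff_le_of_re_nonneg hP (fun z hz hz0 => (hre z hz hz0).le) n.succ_ne_zero
  have hn : (β : ℂ) + (1 - β) * (((n.succ : ℕ) : ℂ) + 1)
      = (((n : ℝ) + 2 - β * ((n : ℝ) + 1) : ℝ) : ℂ) := by
    push_cast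
    ring
  have hpos : 0 ≤ (n : ℝ) + 2 - β * ((n : ℝ) + 1) := by
    nlinarith [hβ.2, (Nat.cast_nonneg n : (0 : ℝ) ≤ n)]
  rw [hn, norm_mul, Complex.norm_real, Real.norm_of_nonneg hpos] at h
  simp only [CharP.cast_eq_zero, zero_add, h1] at h
  norm_num at h
  linarith

theorem stmt12 (β : ℝ) (hβ : β ∈ Set.Icc (0 : ℝ) 1)
    (a : ℕ → ℂ) (f : ℂ → ℂ) (hf : IsAbeta β a f)
    (r : ℝ) (hr : r ∈ Set.Ioo (0 : ℝ) 1) :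
    ∑' n : ℕ, (n : ℝ) * ‖a n‖ ^ 2 * r ^ (2 * n)
      ≤ r ^ 2 + ∑' n : ℕ, (4 * ((n : ℝ) + 2) / (((n : ℝ) + 2) - β * ((n : ℝ) + 1)) ^ 2)
          * r ^ (2 * (n + 2)) := by
  have hr0 := hr.1
  have hden : ∀ n : ℕ, 1 ≤ ((n : ℝ) + 2) - β * ((n : ℝ) + 1) := fun n => by
    nlinarith [hβ.2, (Nat.cast_nonneg n : (0 : ℝ) ≤ n)]
  have hr2 : ‖r ^ 2‖ < 1 := by
    rw [Real.norm_of_nonneg (by positivity)]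
    nlinarith [hr.2]
  have hgeom : Summable fun n : ℕ => 4 * (((n + 2 : ℕ) : ℝ) * (r ^ 2) ^ (n + 2)) := by
    have h := summable_pow_mul_geometric_of_norm_lt_one 1 hr2
    simp only [pow_one] at h
    exact ((summable_nat_add_iff 2).2 h).mul_left 4
  have hR : Summable fun n : ℕ =>
      (4 * ((n : ℝ) + 2) / (((n : ℝ) + 2) - β * ((n : ℝ) + 1)) ^ 2) * r ^ (2 * (n + 2)) := by
    refine Summable.of_nonneg_of_le (fun n => by positivity) (fun n => ?_) hgeom
    rw [← pow_mul, ← mul_assoc]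
    push_cast
    gcongr
    exact div_le_self (by positivity) (one_le_pow₀ (hden n))
  have hterm : ∀ n : ℕ, ((n + 2 : ℕ) : ℝ) * ‖a (n + 2)‖ ^ 2 * r ^ (2 * (n + 2))
      ≤ (4 * ((n : ℝ) + 2) / (((n : ℝ) + 2) - β * ((n : ℝ) + 1)) ^ 2) * r ^ (2 * (n + 2)) := by
    intro n
    gcongr
    rw [le_div_iff₀ (pow_pos (zero_lt_one.trans_le (hden n)) 2), mul_assoc, ← mul_pow]
    have h := hf.norm_coeff_le hβ n
    have h' := pow_le_pow_left₀
      (mul_nonneg (norm_nonneg (a (n + 2))) (zero_le_one.trans (hden n))) h 2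
    push_cast
    nlinarith [(Nat.cast_nonneg n : (0 : ℝ) ≤ n)]
  have hL : Summable fun n : ℕ => ((n + 2 : ℕ) : ℝ) * ‖a (n + 2)‖ ^ 2 * r ^ (2 * (n + 2)) :=
    Summable.of_nonneg_of_le (fun n => by positivity) hterm hR
  have hL' : Summable fun n : ℕ => (n : ℝ) * ‖a n‖ ^ 2 * r ^ (2 * n) :=
    (summable_nat_add_iff 2).1 hL
  rw [← hL'.sum_add_tsum_nat_add 2]
  refine add_le_add (le_of_eq ?_) (hL.tsum_le_tsum hterm hR)
  simp [Finset.sum_range_succ, hf.2.1]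
end

section
/- Let B_1 > 0 be real, B_2 ∈ ℂ, B_3 ∈ ℝ, and let p ∈ 𝒫 with p(z) = 1 + Σ_{n≥1} c_n z^n. Define Ψ₊(c_1,c_2) = |B_2 c_1² + B_3 c_2| − |B_1 c_1|. Then Ψ₊(c_1,c_2) ≤ |4B_2 + 2B_3| − 2B_1 if |2B_2 + B_3| ≥ |B_3| + B_1, and Ψ₊(c_1,c_2) ≤ 2|B_3| otherwise. Both inequalities are sharp. -/
open Metric Filter Set

/-- The Carathéodory class `𝒫`: analytic `p(z) = 1 + ∑_{n≥1} cₙ zⁿ` on the unit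
disk with `Re p(z) > 0`. -/
def IsCara (c : ℕ → ℂ) (p : ℂ → ℂ) : Prop :=
  c 0 = 1 ∧ (∀ z ∈ Metric.ball (0 : ℂ) 1, HasSum (fun n => c n * z ^ n) (p z)) ∧
  ∀ z ∈ Metric.ball (0 : ℂ) 1, 0 < (p z).re

open ComplexConjugate in
/-- The Möbius map `w ↦ (w - a) / (1 - conj a * w)` does not increase the norm above `1`. -/
theorem norm_sub_le_norm_one_sub_conj_mul {a w : ℂ} (ha : ‖a‖ ≤ 1) (hw : ‖w‖ ≤ 1) :
    ‖w - a‖ ≤ ‖1 - conj a * w‖ := by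
  have key : ‖1 - conj a * w‖ ^ 2 - ‖w - a‖ ^ 2 = (1 - ‖a‖ ^ 2) * (1 - ‖w‖ ^ 2) := by
    simp only [Complex.sq_norm, Complex.normSq_apply, Complex.sub_re, Complex.sub_im,
      Complex.mul_re, Complex.mul_im, Complex.conj_re, Complex.conj_im, Complex.one_re,
      Complex.one_im]
    ring
  have : 0 ≤ (1 - ‖a‖ ^ 2) * (1 - ‖w‖ ^ 2) :=
    mul_nonneg (by nlinarith [norm_nonneg a]) (by nlinarith [norm_nonneg w])
  exact le_of_sq_le_sq (by linarith) (norm_nonneg _)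

open ComplexConjugate in
/-- The Schwarz–Pick inequality at the center, for maps into the open unit disk. -/
theorem norm_deriv_zero_le_of_mapsTo_ball {g : ℂ → ℂ} (hd : DifferentiableOn ℂ g (ball 0 1))
    (hg : MapsTo g (ball 0 1) (ball 0 1)) : ‖deriv g 0‖ ≤ 1 - ‖g 0‖ ^ 2 := by
  have h0 : (0 : ℂ) ∈ ball (0 : ℂ) 1 := by simp
  have hlt : ∀ z ∈ ball (0 : ℂ) 1, ‖g z‖ < 1 := fun z hz => by simpa using hg hz
  set a := g 0 with ha
  have ha1 : ‖a‖ < 1 := hlt 0 h0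
  have hne : ∀ z ∈ ball (0 : ℂ) 1, 1 - conj a * g z ≠ 0 := fun z hz h => by
    have h1 : ‖conj a * g z‖ = 1 := by rw [← sub_eq_zero.mp h, norm_one]
    rw [norm_mul, RCLike.norm_conj] at h1
    nlinarith [hlt z hz, norm_nonneg a, norm_nonneg (g z)]
  have hsq : 1 - conj a * a = ((1 - ‖a‖ ^ 2 : ℝ) : ℂ) := by
    rw [mul_comm, Complex.mul_conj, Complex.normSq_eq_norm_sq]
    push_cast
    ring
  have hpos : 0 < 1 - ‖a‖ ^ 2 := by nlinarith [norm_nonneg a]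
  have hderiv : HasDerivAt (fun z => (g z - a) / (1 - conj a * g z))
      (deriv g 0 / ((1 - ‖a‖ ^ 2 : ℝ) : ℂ)) 0 := by
    have hg0 := (hd.differentiableAt (ball_mem_nhds 0 one_pos)).hasDerivAt
    refine ((hg0.sub_const a).div ((hg0.const_mul (conj a)).const_sub 1)
      (hne 0 h0)).congr_deriv ?_
    have hne' := hne 0 h0
    rw [← ha] at hne' ⊢
    rw [← hsq]
    field_simp
    ring
  have hm := Complex.norm_deriv_le_one_of_mapsTo_ball
    (f := fun z => (g z - a) / (1 - conj a * g z)) (c := 0) (R := 1)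
    ((hd.sub_const a).div ((hd.const_mul (conj a)).const_sub 1) hne)
    (fun z hz => by
      simp only [← ha, sub_self, zero_div, mem_closedBall_zero_iff, norm_div]
      exact div_le_one_of_le₀
        (norm_sub_le_norm_one_sub_conj_mul ha1.le (hlt z hz).le) (norm_nonneg _)) one_pos
  rwa [hderiv.deriv, norm_div, Complex.norm_of_nonneg hpos.le, div_le_one hpos] at hm

/-- The Schwarz–Pick inequality at the center, for maps into the closed unit disk. -/
theorem norm_deriv_zero_le_of_mapsTo_closedBall {g : ℂ → ℂ}
    (hd : DifferentiableOn ℂ g (ball 0 1)) (hg : MapsTo g (ball 0 1) (closedBall 0 1)) :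
    ‖deriv g 0‖ ≤ 1 - ‖g 0‖ ^ 2 := by
  have hr : ∀ r ∈ Ioo (0 : ℝ) 1, r * ‖deriv g 0‖ ≤ 1 - (r * ‖g 0‖) ^ 2 := fun r hr => by
    have h := norm_deriv_zero_le_of_mapsTo_ball (g := fun z => (r : ℂ) * g z)
      (hd.const_mul _) (fun z hz => by
        have := hg hz
        rw [mem_closedBall_zero_iff] at this
        rw [mem_ball_zero_iff, norm_mul, Complex.norm_of_nonneg hr.1.le]
        nlinarith [hr.1, hr.2])
    rwa [deriv_const_mul _ (hd.differentiableAt (ball_mem_nhds 0 one_pos)), norm_mul, norm_mul,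
      Complex.norm_of_nonneg hr.1.le] at h
  have hmem : ∀ᶠ r in nhdsWithin (1 : ℝ) (Iio 1), r ∈ Ioo (0 : ℝ) 1 :=
    Ioo_mem_nhdsLT one_pos
  have hl : Tendsto (fun r : ℝ => r * ‖deriv g 0‖) (nhdsWithin 1 (Iio 1))
      (nhds (1 * ‖deriv g 0‖)) :=
    (Continuous.tendsto (by fun_prop) 1).mono_left nhdsWithin_le_nhds
  have hu : Tendsto (fun r : ℝ => 1 - (r * ‖g 0‖) ^ 2) (nhdsWithin 1 (Iio 1))
      (nhds (1 - (1 * ‖g 0‖) ^ 2)) :=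
    (Continuous.tendsto (by fun_prop) 1).mono_left nhdsWithin_le_nhds
  simpa using le_of_tendsto_of_tendsto hl hu (hmem.mono hr)

namespace IsCara

variable {c d : ℕ → ℂ} {p q : ℂ → ℂ}

open FormalMultilinearSeries in
theorem hasFPowerSeriesOnBall (h : IsCara c p) :
    HasFPowerSeriesOnBall p (ofScalars ℂ c) 0 1 where
  r_le := by
    refine ENNReal.le_of_forall_nnreal_lt fun r hr => ?_
    have hr1 : (r : ℝ) < 1 := by exact_mod_cast hr
    have hs := (h.2.1 (r : ℝ) (by simpa using hr1)).summable.tendsto_atTop_zero.norm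
    refine le_radius_of_tendsto _ (l := 0) ?_
    simpa [ofScalars_norm] using hs
  r_pos := one_pos
  hasSum := fun {y} hy => by
    have hy1 : y ∈ ball (0 : ℂ) 1 := by
      rw [← Metric.eball_ofReal]
      simpa using hy
    simpa [ofScalars_apply_eq, mul_comm] using h.2.1 y hy1

theorem apply_zero (h : IsCara c p) : p 0 = 1 := by
  have h0 := h.hasFPowerSeriesOnBall.coeff_zero (fun _ => 0)
  simpa [FormalMultilinearSeries.ofScalars_apply_eq, h.1] using h0.symm

theorem differentiableOn (h : IsCara c p) : DifferentiableOn ℂ p (ball 0 1) := by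
  have := h.hasFPowerSeriesOnBall.differentiableOn
  rwa [← ENNReal.ofReal_one, Metric.eball_ofReal] at this

theorem deriv_zero (h : IsCara c p) : deriv p 0 = c 1 := by
  simpa [FormalMultilinearSeries.ofScalars_apply_eq] using
    h.hasFPowerSeriesOnBall.hasFPowerSeriesAt.deriv

theorem deriv_dslope_zero (h : IsCara c p) : deriv (dslope p 0) 0 = c 2 := by
  have := h.hasFPowerSeriesOnBall.hasFPowerSeriesAt.has_fpower_series_dslope_fslope.deriv
  change _ = FormalMultilinearSeries.coeff _ 1 at this
  rw [this, FormalMultilinearSeries.coeff_fslope, FormalMultilinearSeries.coeff_ofScalars]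

theorem add_one_ne_zero (h : IsCara c p) {z : ℂ} (hz : z ∈ ball (0 : ℂ) 1) : p z + 1 ≠ 0 := by
  intro h0
  have := congrArg Complex.re h0
  have hre := h.2.2 z hz
  simp only [Complex.add_re, Complex.one_re, Complex.zero_re] at this
  linarith

theorem norm_sub_one_le (h : IsCara c p) {z : ℂ} (hz : z ∈ ball (0 : ℂ) 1) :
    ‖p z - 1‖ ≤ ‖p z + 1‖ := by
  refine le_of_sq_le_sq ?_ (norm_nonneg _)
  have hre := h.2.2 z hz
  simp only [Complex.sq_norm, Complex.normSq_apply, Complex.sub_re, Complex.sub_im,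
    Complex.add_re, Complex.add_im, Complex.one_re, Complex.one_im]
  linarith

/-- The sharp bound for the second coefficient of a Carathéodory function in terms of the
first. -/
theorem norm_coeff_two_sub_le (h : IsCara c p) :
    ‖c 2 - c 1 ^ 2 / 2‖ ≤ 2 - ‖c 1‖ ^ 2 / 2 := by
  have h0 : (0 : ℂ) ∈ ball (0 : ℂ) 1 := by simp
  have hnhds : ball (0 : ℂ) 1 ∈ nhds (0 : ℂ) := ball_mem_nhds 0 one_pos
  have hs : DifferentiableOn ℂ (dslope p 0) (ball 0 1) :=
    (Complex.differentiableOn_dslope hnhds).2 h.differentiableOn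
  have hp1 : DifferentiableOn ℂ (fun z => p z + 1) (ball 0 1) := h.differentiableOn.add_const 1
  set w : ℂ → ℂ := fun z => (p z - 1) / (p z + 1) with hw
  have hwd : DifferentiableOn ℂ w (ball 0 1) :=
    (h.differentiableOn.sub_const 1).div hp1 fun z hz => h.add_one_ne_zero hz
  have hw0 : w 0 = 0 := by simp [hw, h.apply_zero]
  have hwm : MapsTo w (ball 0 1) (closedBall (w 0) 1) := fun z hz => by
    rw [hw0, mem_closedBall_zero_iff, norm_div]
    exact div_le_one_of_le₀ (h.norm_sub_one_le hz) (norm_nonneg _)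
  have hpd := (h.differentiableOn.differentiableAt hnhds).hasDerivAt
  rw [h.deriv_zero] at hpd
  have hwderiv : deriv w 0 = c 1 / 2 := by
    refine (((hpd.sub_const 1).div (hpd.add_const 1) (h.add_one_ne_zero h0)).congr_deriv ?_).deriv
    rw [h.apply_zero]
    ring
  have heq : EqOn (fun z => dslope p 0 z / (p z + 1)) (dslope w 0) (ball 0 1) := fun z hz => by
    rcases eq_or_ne z 0 with rfl | hne
    · simp only [dslope_same, h.deriv_zero, h.apply_zero, hwderiv]
      norm_num
    · have := h.add_one_ne_zero hz
      simp only [dslope_of_ne _ hne, slope_def_field, h.apply_zero, hw]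
      field_simp
      simp
  have hgderiv : deriv (fun z => dslope p 0 z / (p z + 1)) 0 = (c 2 - c 1 ^ 2 / 2) / 2 := by
    have hsd := (hs.differentiableAt hnhds).hasDerivAt
    rw [h.deriv_dslope_zero] at hsd
    refine ((hsd.div (hpd.add_const 1) (h.add_one_ne_zero h0)).congr_deriv ?_).deriv
    rw [h.apply_zero, dslope_same, h.deriv_zero]
    ring
  have hsp := norm_deriv_zero_le_of_mapsTo_closedBall
    (g := fun z => dslope p 0 z / (p z + 1)) (hs.div hp1 fun z hz => h.add_one_ne_zero hz)
    (fun z hz => by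
      rw [mem_closedBall_zero_iff, heq hz]
      simpa using Complex.norm_dslope_le_div_of_mapsTo_ball hwd hwm hz)
  rw [hgderiv] at hsp
  simp only [dslope_same, h.deriv_zero, h.apply_zero, norm_div, one_add_one_eq_two,
    Complex.norm_ofNat] at hsp
  linarith

theorem norm_coeff_one_le (h : IsCara c p) : ‖c 1‖ ≤ 2 := by
  nlinarith [h.norm_coeff_two_sub_le, norm_nonneg (c 2 - c 1 ^ 2 / 2), norm_nonneg (c 1)]

/-- The half-plane map `z ↦ (1 + ε z) / (1 - ε z)` is a Carathéodory function. -/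
theorem halfPlane {ε : ℂ} (hε : ‖ε‖ ≤ 1) :
    IsCara (fun n => 2 * ε ^ n - if n = 0 then 1 else 0)
      (fun z => 2 * (1 - ε * z)⁻¹ - 1) := by
  have hlt : ∀ z ∈ ball (0 : ℂ) 1, ‖ε * z‖ < 1 := fun z hz => by
    rw [mem_ball_zero_iff] at hz
    rw [norm_mul]
    nlinarith [norm_nonneg z, norm_nonneg ε]
  refine ⟨by norm_num, fun z hz => ?_, fun z hz => ?_⟩
  · have h1 := (hasSum_geometric_of_norm_lt_one (hlt z hz)).mul_left 2
    have h2 := hasSum_ite_eq (0 : ℕ) (1 : ℂ)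
    refine (h1.sub h2).congr_fun ?_
    intro n
    rcases eq_or_ne n 0 with rfl | hn
    · simp
    · simp [hn, mul_pow, mul_assoc]
  · have hn := hlt z hz
    set w := ε * z
    have hsq : Complex.normSq w < 1 := by
      rw [Complex.normSq_eq_norm_sq]
      nlinarith [norm_nonneg w]
    have hne : 1 - w ≠ 0 := fun h => by
      rw [← sub_eq_zero.mp h, norm_one] at hn
      exact lt_irrefl _ hn
    have hpos := Complex.normSq_pos.2 hne
    have hre : (2 * (1 - w)⁻¹ - 1).re = (1 - Complex.normSq w) / Complex.normSq (1 - w) := by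
      have : (2 * (1 - w)⁻¹ - 1).re = 2 * ((1 - w).re / Complex.normSq (1 - w)) - 1 := by
        simp [Complex.inv_re]
      rw [this]
      field_simp
      simp only [Complex.normSq_apply, Complex.sub_re, Complex.sub_im, Complex.one_re,
        Complex.one_im]
      ring
    rw [hre]
    exact div_pos (by linarith) hpos

theorem midpoint (hp : IsCara c p) (hq : IsCara d q) :
    IsCara (fun n => (c n + d n) / 2) (fun z => (p z + q z) / 2) := by
  refine ⟨by norm_num [hp.1, hq.1], fun z hz => ?_, fun z hz => ?_⟩
  · refine (((hp.2.1 z hz).add (hq.2.1 z hz)).div_const 2).congr_fun ?_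
    intro n
    ring
  · have h1 := hp.2.2 z hz
    have h2 := hq.2.2 z hz
    simp only [Complex.div_ofNat_re, Complex.add_re]
    linarith

theorem norm_functional_le (h : IsCara c p) (B2 : ℂ) (B3 : ℝ) :
    ‖B2 * c 1 ^ 2 + (B3 : ℂ) * c 2‖
      ≤ ‖2 * B2 + (B3 : ℂ)‖ * ‖c 1‖ ^ 2 / 2 + |B3| * (2 - ‖c 1‖ ^ 2 / 2) := by
  have heq : B2 * c 1 ^ 2 + (B3 : ℂ) * c 2
      = (2 * B2 + (B3 : ℂ)) * c 1 ^ 2 / 2 + (B3 : ℂ) * (c 2 - c 1 ^ 2 / 2) := by ring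
  rw [heq]
  refine (norm_add_le _ _).trans ?_
  rw [norm_div, norm_mul, norm_mul, norm_pow, Complex.norm_ofNat, Complex.norm_real,
    Real.norm_eq_abs]
  gcongr
  exact h.norm_coeff_two_sub_le

end IsCara

theorem stmt16 (B1 : ℝ) (hB1 : 0 < B1) (B2 : ℂ) (B3 : ℝ)
    (c : ℕ → ℂ) (P : ℂ → ℂ) (hP : IsCara c P) :
    (|B3| + B1 ≤ ‖2 * B2 + (B3 : ℂ)‖ →
      ‖B2 * (c 1) ^ 2 + (B3 : ℂ) * c 2‖ - ‖(B1 : ℂ) * c 1‖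
        ≤ ‖4 * B2 + 2 * (B3 : ℂ)‖ - 2 * B1) ∧
    (‖2 * B2 + (B3 : ℂ)‖ < |B3| + B1 →
      ‖B2 * (c 1) ^ 2 + (B3 : ℂ) * c 2‖ - ‖(B1 : ℂ) * c 1‖ ≤ 2 * |B3|) ∧
    -- sharpness in each regime
    (|B3| + B1 ≤ ‖2 * B2 + (B3 : ℂ)‖ →
      ∃ b Q, IsCara b Q ∧
        ‖B2 * (b 1) ^ 2 + (B3 : ℂ) * b 2‖ - ‖(B1 : ℂ) * b 1‖
          = ‖4 * B2 + 2 * (B3 : ℂ)‖ - 2 * B1) ∧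
    (‖2 * B2 + (B3 : ℂ)‖ < |B3| + B1 →
      ∃ b Q, IsCara b Q ∧
        ‖B2 * (b 1) ^ 2 + (B3 : ℂ) * b 2‖ - ‖(B1 : ℂ) * b 1‖ = 2 * |B3|) := by
  have h4 : ‖4 * B2 + 2 * (B3 : ℂ)‖ = 2 * ‖2 * B2 + (B3 : ℂ)‖ := by
    rw [show 4 * B2 + 2 * (B3 : ℂ) = 2 * (2 * B2 + (B3 : ℂ)) by ring, norm_mul,
      Complex.norm_ofNat]
  have hB1c : ∀ z : ℂ, ‖(B1 : ℂ) * z‖ = B1 * ‖z‖ := fun z => by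
    rw [norm_mul, Complex.norm_of_nonneg hB1.le]
  have hf := hP.norm_functional_le B2 B3
  have hx := hP.norm_coeff_one_le
  have hx0 := norm_nonneg (c 1)
  refine ⟨fun h => ?_, fun h => ?_, fun _ => ?_, fun _ => ?_⟩
  · rw [h4, hB1c]
    nlinarith [mul_nonneg (sub_nonneg.2 hx) hx0, mul_nonneg (sub_nonneg.2 h) (sub_nonneg.2 hx),
      mul_nonneg (mul_nonneg (sub_nonneg.2 h) (sub_nonneg.2 hx)) hx0]
  · rw [hB1c]
    nlinarith [mul_nonneg (sub_nonneg.2 hx) hx0,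
      mul_nonneg (sub_nonneg.2 h.le) (sq_nonneg ‖c 1‖)]
  · refine ⟨_, _, IsCara.halfPlane (ε := 1) (by simp), ?_⟩
    rw [h4, hB1c]
    norm_num
    rw [show B2 * 4 + (B3 : ℂ) * 2 = 2 * (2 * B2 + (B3 : ℂ)) by ring, norm_mul,
      Complex.norm_ofNat]
    ring
  · refine ⟨_, _, (IsCara.halfPlane (ε := 1) (by simp)).midpoint
      (IsCara.halfPlane (ε := -1) (by simp)), ?_⟩
    norm_num
    ring
end

section
/- Let B_1 > 0 be real, B_2 ∈ ℂ, B_3 ∈ ℝ, and let p ∈ 𝒫 with p(z) = 1 + Σ_{n≥1} c_n z^n. Define Ψ₋(c_1,c_2) = |B_1 c_1| − |B_2 c_1² + B_3 c_2| and B_4 = |4B_2 + 2B_3|. Then Ψ₋(c_1,c_2) ≤ 2B_1 − B_4 if B_1 ≥ B_4 + 2|B_3|; Ψ₋(c_1,c_2) ≤ 2B_1 √(2|B_3|/(B_4 + 2|B_3|)) if B_1² ≤ 2|B_3|(B_4 + 2|B_3|); and Ψ₋(c_1,c_2) ≤ 2|B_3| + B_1²/(B_4 + 2|B_3|) otherwise.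 All inequalities are sharp. -/
open Metric Filter Set

/-- A function given by a power series on the unit disk has that expansion in Mathlib's sense. -/
theorem hasFPowerSeriesOnBall_of_hasSum {c : ℕ → ℂ} {f : ℂ → ℂ}
    (h : ∀ z ∈ ball (0 : ℂ) 1, HasSum (fun n => c n * z ^ n) (f z)) :
    HasFPowerSeriesOnBall f (FormalMultilinearSeries.ofScalars ℂ c) 0 1 := by
  constructor
  · refine le_of_forall_lt_imp_le_of_dense fun r hr ↦ ?_
    lift r to NNReal using hr.ne_top
    apply FormalMultilinearSeries.le_radius_of_summable
    simpa [norm_mul] using (h r (by simpa using hr)).summable.norm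
  · simp
  · intro y hy
    rw [← ENNReal.coe_one, Metric.eball_coe, NNReal.coe_one] at hy
    simpa [mul_comm] using h y hy

theorem hasDerivAt_zero_of_hasSum {c : ℕ → ℂ} {f : ℂ → ℂ}
    (h : ∀ z ∈ ball (0 : ℂ) 1, HasSum (fun n => c n * z ^ n) (f z)) :
    HasDerivAt f (c 1) 0 := by
  have := (hasFPowerSeriesOnBall_of_hasSum h).hasFPowerSeriesAt.hasDerivAt
  simpa using this

theorem differentiableOn_of_hasSum {c : ℕ → ℂ} {f : ℂ → ℂ}
    (h : ∀ z ∈ ball (0 : ℂ) 1, HasSum (fun n => c n * z ^ n) (f z)) :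
    DifferentiableOn ℂ f (ball 0 1) := by
  have := (hasFPowerSeriesOnBall_of_hasSum h).differentiableOn
  rwa [← ENNReal.coe_one, Metric.eball_coe, NNReal.coe_one] at this

theorem apply_zero_of_hasSum {c : ℕ → ℂ} {f : ℂ → ℂ}
    (h : ∀ z ∈ ball (0 : ℂ) 1, HasSum (fun n => c n * z ^ n) (f z)) : f 0 = c 0 := by
  refine (h 0 (by simp)).unique ?_
  convert hasSum_single (f := fun n => c n * (0 : ℂ) ^ n) 0 (by simp +contextual) using 1
  simp

/-- Removing the constant term of a power series and dividing by the variable. -/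
theorem exists_eq_add_mul_of_hasSum {c : ℕ → ℂ} {f : ℂ → ℂ}
    (h : ∀ z ∈ ball (0 : ℂ) 1, HasSum (fun n => c n * z ^ n) (f z)) :
    ∃ q : ℂ → ℂ, (∀ z ∈ ball (0 : ℂ) 1, HasSum (fun n => c (n + 1) * z ^ n) (q z)) ∧
      ∀ z ∈ ball (0 : ℂ) 1, f z = c 0 + z * q z := by
  have hs : ∀ z ∈ ball (0 : ℂ) 1, Summable (fun n => c (n + 1) * z ^ n) := by
    intro z hz
    rcases eq_or_ne z 0 with rfl | hz0
    · exact summable_of_ne_finset_zero (s := {0}) fun n hn => by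
        simp [zero_pow (Finset.notMem_singleton.mp hn)]
    · refine (((summable_nat_add_iff 1).mpr (h z hz).summable).mul_left z⁻¹).congr fun n => ?_
      rw [inv_mul_eq_iff_eq_mul₀ hz0]
      ring
  refine ⟨fun z => ∑' n, c (n + 1) * z ^ n, fun z hz => (hs z hz).hasSum, fun z hz => ?_⟩
  refine (h z hz).unique ?_
  have h1 : HasSum (fun n => c (n + 1) * z ^ (n + 1)) (z * ∑' n, c (n + 1) * z ^ n) := by
    simpa only [pow_succ', mul_left_comm] using (hs z hz).hasSum.mul_left z
  simpa using h1.zero_add (f := fun n => c n * z ^ n)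

/-- Schwarz–Pick at the origin, for self-maps of the open unit disk. -/
theorem norm_deriv_zero_le_one_sub_sq_of_norm_lt_one {f : ℂ → ℂ} {f' : ℂ}
    (hd : DifferentiableOn ℂ f (ball 0 1)) (hf : ∀ z ∈ ball (0 : ℂ) 1, ‖f z‖ < 1)
    (hf' : HasDerivAt f f' 0) : ‖f'‖ ≤ 1 - ‖f 0‖ ^ 2 := by
  set a := f 0 with ha
  have ha1 : ‖a‖ < 1 := hf 0 (by simp)
  have hne : ∀ w : ℂ, ‖w‖ < 1 → 1 - (starRingEnd ℂ) a * w ≠ 0 := by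
    intro w hw h0
    have : ‖(starRingEnd ℂ) a * w‖ = 1 := by rw [← sub_eq_zero.mp h0]; simp
    rw [norm_mul, RCLike.norm_conj] at this
    nlinarith [norm_nonneg a, norm_nonneg w]
  let g : ℂ → ℂ := fun z => (f z - a) / (1 - (starRingEnd ℂ) a * f z)
  have hgd : DifferentiableOn ℂ g (ball 0 1) :=
    (hd.sub_const a).div ((hd.const_mul _).const_sub 1) fun z hz => hne _ (hf z hz)
  have hg0 : g 0 = 0 := by simp [g, ← ha]
  have hmaps : MapsTo g (ball 0 1) (closedBall (g 0) 1) := by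
    intro z hz
    have hz1 := hf z hz
    rw [hg0, mem_closedBall_zero_iff, norm_div, div_le_one (norm_pos_iff.mpr (hne _ hz1))]
    refine (sq_le_sq₀ (norm_nonneg _) (norm_nonneg _)).mp ?_
    have h1 : ‖f z‖ ^ 2 ≤ 1 := by nlinarith [norm_nonneg (f z)]
    have h2 : ‖a‖ ^ 2 ≤ 1 := by nlinarith [norm_nonneg a]
    rw [← Complex.normSq_eq_norm_sq, Complex.normSq_apply] at h1 h2
    rw [← Complex.normSq_eq_norm_sq, ← Complex.normSq_eq_norm_sq, Complex.normSq_apply,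
      Complex.normSq_apply]
    simp
    nlinarith [mul_nonneg (sub_nonneg.mpr h1) (sub_nonneg.mpr h2)]
  have hgder : HasDerivAt g (f' / (1 - ‖a‖ ^ 2 : ℝ)) 0 := by
    have h1 : HasDerivAt g _ 0 := (hf'.sub_const a).div
      ((hf'.const_mul ((starRingEnd ℂ) a)).const_sub 1) (hne _ ha1)
    refine h1.congr_deriv ?_
    have h3 := hne _ ha1
    rw [← ha, sub_self]
    rw [mul_comm _ a, Complex.mul_conj, Complex.normSq_eq_norm_sq] at h3 ⊢
    push_cast at h3 ⊢
    field_simp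
    ring
  have h := Complex.norm_deriv_le_one_of_mapsTo_ball hgd hmaps one_pos
  have hpos : 0 < 1 - ‖a‖ ^ 2 := by nlinarith [norm_nonneg a]
  rwa [hgder.deriv, norm_div, Complex.norm_real, Real.norm_of_nonneg hpos.le,
    div_le_one hpos] at h

/-- Schwarz–Pick at the origin, for maps into the closed unit disk. -/
theorem norm_deriv_zero_le_one_sub_sq {f : ℂ → ℂ} {f' : ℂ}
    (hd : DifferentiableOn ℂ f (ball 0 1)) (hf : ∀ z ∈ ball (0 : ℂ) 1, ‖f z‖ ≤ 1)
    (hf' : HasDerivAt f f' 0) : ‖f'‖ ≤ 1 - ‖f 0‖ ^ 2 := by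
  have key : ∀ r ∈ Ioo (0 : ℝ) 1, r * ‖f'‖ ≤ 1 - (r * ‖f 0‖) ^ 2 := by
    intro r hr
    have := norm_deriv_zero_le_one_sub_sq_of_norm_lt_one (hd.const_mul (r : ℂ))
      (fun z hz => by
        rw [norm_mul, Complex.norm_real, Real.norm_of_nonneg hr.1.le]
        nlinarith [hf z hz, hr.1, hr.2]) (hf'.const_mul (r : ℂ))
    simpa [abs_of_pos hr.1] using this
  have hcl : (1 : ℝ) ∈ closure (Ioo (0 : ℝ) 1) := by
    rw [closure_Ioo zero_ne_one]; simp
  have := le_on_closure key (by fun_prop) (by fun_prop) hcl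
  simpa using this

/-- Coefficient bounds for the Carathéodory class. -/
theorem IsCara.coeff_bound {c : ℕ → ℂ} {P : ℂ → ℂ} (hP : IsCara c P) :
    ‖c 1 / 2‖ ≤ 1 ∧ ‖c 2 / 2 - (c 1 / 2) ^ 2‖ ≤ 1 - ‖c 1 / 2‖ ^ 2 := by
  obtain ⟨h0, hs, hre⟩ := hP
  obtain ⟨q, hq, hPq⟩ := exists_eq_add_mul_of_hasSum hs
  have hP1 : ∀ z ∈ ball (0 : ℂ) 1, P z + 1 ≠ 0 := by
    intro z hz h
    have := congrArg Complex.re h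
    simp at this
    linarith [hre z hz]
  have hPd := differentiableOn_of_hasSum hs
  have hP0 : P 0 = 1 := (apply_zero_of_hasSum hs).trans h0
  let w : ℂ → ℂ := fun z => (P z - 1) / (P z + 1)
  have hwd : DifferentiableOn ℂ w (ball 0 1) := (hPd.sub_const 1).div (hPd.add_const 1) hP1
  have hw0 : w 0 = 0 := by simp [w, hP0]
  have hmaps : MapsTo w (ball 0 1) (closedBall 0 1) := by
    intro z hz
    rw [mem_closedBall_zero_iff, norm_div, div_le_one (norm_pos_iff.mpr (hP1 z hz))]
    refine (sq_le_sq₀ (norm_nonneg _) (norm_nonneg _)).mp ?_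
    rw [← Complex.normSq_eq_norm_sq, ← Complex.normSq_eq_norm_sq, Complex.normSq_apply,
      Complex.normSq_apply]
    simp
    nlinarith [hre z hz]
  have hg0 : q 0 = c 1 := apply_zero_of_hasSum hq
  have hgder : HasDerivAt (fun z => q z / (P z + 1)) (c 2 / 2 - (c 1 / 2) ^ 2) 0 := by
    have h1 : HasDerivAt (fun z => q z / (P z + 1)) _ 0 := (hasDerivAt_zero_of_hasSum hq).div
      ((hasDerivAt_zero_of_hasSum hs).add_const 1) (hP1 0 (by simp))
    refine h1.congr_deriv ?_
    rw [hP0, hg0]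
    norm_num
    ring
  have hgd : DifferentiableOn ℂ (fun z => q z / (P z + 1)) (ball 0 1) :=
    (differentiableOn_of_hasSum hq).div (hPd.add_const 1) hP1
  have hwg : ∀ z ∈ ball (0 : ℂ) 1, w z = z * (q z / (P z + 1)) := by
    intro z hz
    simp only [w]
    rw [mul_div_assoc', hPq z hz, h0]
    ring_nf
  have hwder : HasDerivAt w (c 1 / 2) 0 := by
    have hD := hasDerivAt_zero_of_hasSum hs
    have h1 : HasDerivAt w _ 0 := (hD.sub_const 1).div (hD.add_const 1) (hP1 0 (by simp))
    refine h1.congr_deriv ?_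
    rw [hP0]
    ring
  have hb1 : ‖c 1 / 2‖ ≤ 1 := by
    rw [← hwder.deriv]
    exact Complex.norm_deriv_le_one_of_mapsTo_ball hwd (by rwa [hw0]) one_pos
  refine ⟨hb1, ?_⟩
  have hg0' : q 0 / (P 0 + 1) = c 1 / 2 := by rw [hg0, hP0]; norm_num
  have := norm_deriv_zero_le_one_sub_sq hgd (fun z hz => ?_) hgder
  · rwa [hg0'] at this
  rcases eq_or_ne z 0 with rfl | hz0
  · rwa [hg0']
  have h1 := Complex.norm_le_norm_of_mapsTo_ball hwd hmaps hw0 (mem_ball_zero_iff.mp hz)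
  rw [hwg z hz, norm_mul] at h1
  exact le_of_mul_le_mul_left (by simpa using h1) (norm_pos_iff.mpr hz0)

/-- Every pair `(a, ε (1 - a²))`, with `0 ≤ a ≤ 1` and `|ε| = 1`, consists of the first two
coefficients of the Schwarz function of a member of the Carathéodory class. -/
theorem exists_isCara {x : ℝ} (hx0 : 0 ≤ x) (hx1 : x ≤ 1) {e : ℂ} (he : ‖e‖ = 1) :
    ∃ b Q, IsCara b Q ∧ b 1 = 2 * x ∧ b 2 = 2 * (e * (1 - x ^ 2)) + 2 * x ^ 2 := by
  have hlt : ∀ z ∈ ball (0 : ℂ) 1, ‖(x : ℂ) * (e * z)‖ < 1 := by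
    intro z hz
    rw [mem_ball_zero_iff] at hz
    rw [norm_mul, norm_mul, he, Complex.norm_real, Real.norm_of_nonneg hx0]
    nlinarith [norm_nonneg z]
  have hne : ∀ z ∈ ball (0 : ℂ) 1, 1 + (x : ℂ) * (e * z) ≠ 0 := by
    intro z hz h0
    have := hlt z hz
    rw [← norm_neg, ← eq_neg_of_add_eq_zero_left h0] at this
    simp at this
  let g : ℂ → ℂ := fun z => (x + e * z) / (1 + x * (e * z))
  have hgle : ∀ z ∈ ball (0 : ℂ) 1, ‖g z‖ ≤ 1 := by
    intro z hz
    have hez : ‖e * z‖ < 1 := by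
      rw [norm_mul, he, one_mul]; exact mem_ball_zero_iff.mp hz
    rw [norm_div, div_le_one (norm_pos_iff.mpr (hne z hz))]
    refine (sq_le_sq₀ (norm_nonneg _) (norm_nonneg _)).mp ?_
    have h1 : ‖e * z‖ ^ 2 ≤ 1 := by nlinarith [norm_nonneg (e * z)]
    generalize e * z = u at h1
    rw [← Complex.normSq_eq_norm_sq, Complex.normSq_apply] at h1
    rw [← Complex.normSq_eq_norm_sq, ← Complex.normSq_eq_norm_sq, Complex.normSq_apply,
      Complex.normSq_apply]
    simp
    nlinarith [mul_nonneg (sub_nonneg.mpr h1) (show 0 ≤ 1 - x ^ 2 by nlinarith)]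
  have hw : ∀ z ∈ ball (0 : ℂ) 1, ‖z * g z‖ < 1 := by
    intro z hz
    rw [norm_mul]
    nlinarith [hgle z hz, norm_nonneg z, mem_ball_zero_iff.mp hz, norm_nonneg (g z)]
  have hw1 : ∀ z ∈ ball (0 : ℂ) 1, 1 - z * g z ≠ 0 := by
    intro z hz h0
    have := hw z hz
    rw [← sub_eq_zero.mp h0] at this
    simp at this
  have hgd : DifferentiableOn ℂ g (ball 0 1) :=
    DifferentiableOn.div (by fun_prop) (by fun_prop) hne
  let r : ℂ → ℂ := fun z =>
    2 * (e * (1 - x ^ 2) / (1 + x * (e * z))) + 2 * g z ^ 2 / (1 - z * g z)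
  have hrd : DifferentiableOn ℂ r (ball 0 1) := by
    refine DifferentiableOn.add (DifferentiableOn.const_mul
      (DifferentiableOn.div (by fun_prop) (by fun_prop) hne) 2)
      (DifferentiableOn.div (by fun_prop) (by fun_prop) hw1)
  let b : ℕ → ℂ
    | 0 => 1
    | 1 => 2 * x
    | n + 2 => (n.factorial : ℂ)⁻¹ * iteratedDeriv n r 0
  refine ⟨b, fun z => (1 + z * g z) / (1 - z * g z), ⟨rfl, fun z hz => ?_, fun z hz => ?_⟩,
    rfl, ?_⟩
  · have h1 := Complex.hasSum_taylorSeries_on_ball hrd hz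
    rw [← hasSum_nat_add_iff' 2]
    have hv : (1 + z * g z) / (1 - z * g z) - ∑ n ∈ Finset.range 2, b n * z ^ n
        = z ^ 2 * r z := by
      have h2 := hw1 z hz
      have hg : g z = x + z * (e * (1 - x ^ 2) / (1 + x * (e * z))) := by
        have h3 := hne z hz
        simp only [g]
        rw [mul_div_assoc', eq_comm, add_div' _ _ _ h3]
        ring
      simp only [Finset.sum_range_succ, Finset.sum_range_zero, b, r]
      generalize e * (1 - (x : ℂ) ^ 2) / (1 + x * (e * z)) = H at hg
      rw [hg] at h2 ⊢
      field_simp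
      ring
    rw [hv]
    simpa [b, pow_add, mul_comm, mul_assoc, mul_left_comm] using h1.mul_left (z ^ 2)
  · have h1 := hw z hz
    beta_reduce
    generalize z * g z = u at h1 ⊢
    have h2 : ‖u‖ ^ 2 < 1 := by nlinarith [norm_nonneg u]
    have h3 : (1 : ℂ) - u ≠ 0 := by
      intro h0
      rw [← sub_eq_zero.mp h0] at h1
      simp at h1
    have h4 := Complex.normSq_pos.mpr h3
    rw [← Complex.normSq_eq_norm_sq, Complex.normSq_apply] at h2
    rw [Complex.div_re, ← add_div]
    refine div_pos ?_ h4
    simp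
    nlinarith
  · simp [b, r, g]

/-- The value of `Ψ₋` at the extremal functions. -/
theorem exists_isCara_psi_eq {B1 : ℝ} (hB1 : 0 < B1) (B2 : ℂ) (B3 : ℝ) {x : ℝ} (hx0 : 0 ≤ x)
    (hx1 : x ≤ 1) (hx : 2 * |B3| ≤ (‖4 * B2 + 2 * (B3 : ℂ)‖ + 2 * |B3|) * x ^ 2) :
    ∃ b Q, IsCara b Q ∧
      ‖(B1 : ℂ) * b 1‖ - ‖B2 * (b 1) ^ 2 + (B3 : ℂ) * b 2‖
        = 2 * B1 * x - ((‖4 * B2 + 2 * (B3 : ℂ)‖ + 2 * |B3|) * x ^ 2 - 2 * |B3|) := by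
  obtain ⟨u, hu, hu'⟩ := Complex.exists_norm_mul_eq_self (4 * B2 + 2 * (B3 : ℂ))
  obtain ⟨s, hs, hs'⟩ : ∃ s : ℝ, s * s = 1 ∧ s * B3 = |B3| := by
    rcases abs_cases B3 with h | h
    · exact ⟨1, by simp [h.1]⟩
    · exact ⟨-1, by simp [h.1]⟩
  have hs1 : |s| = 1 := by
    have := abs_mul_abs_self s
    nlinarith [abs_nonneg s]
  obtain ⟨b, Q, hQ, hb1, hb2⟩ := exists_isCara hx0 hx1 (e := -(s * u)) (by simp [hu, hs1])
  refine ⟨b, Q, hQ, ?_⟩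
  have hs'' : (s : ℂ) * B3 = (|B3| : ℝ) := by rw [← hs']; simp
  generalize ‖4 * B2 + 2 * (B3 : ℂ)‖ = B4 at *
  have h : B2 * (b 1) ^ 2 + (B3 : ℂ) * b 2
      = u * (((B4 + 2 * |B3|) * x ^ 2 - 2 * |B3| : ℝ) : ℂ) := by
    rw [hb1, hb2]
    push_cast
    linear_combination (-(x : ℂ) ^ 2) * hu' - 2 * u * (1 - x ^ 2) * hs''
  rw [h, hb1, norm_mul u, hu, Complex.norm_real, Real.norm_of_nonneg (sub_nonneg.mpr hx)]
  simp [abs_of_pos hB1, abs_of_nonneg hx0]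
  ring

theorem stmt17 (B1 : ℝ) (hB1 : 0 < B1) (B2 : ℂ) (B3 : ℝ)
    (c : ℕ → ℂ) (P : ℂ → ℂ) (hP : IsCara c P) :
    -- with `B₄ = |4B₂ + 2B₃|` and `Ψ₋(c₁,c₂) = |B₁c₁| - |B₂c₁² + B₃c₂|`
    (‖4 * B2 + 2 * (B3 : ℂ)‖ + 2 * |B3| ≤ B1 →
      ‖(B1 : ℂ) * c 1‖ - ‖B2 * (c 1) ^ 2 + (B3 : ℂ) * c 2‖
        ≤ 2 * B1 - ‖4 * B2 + 2 * (B3 : ℂ)‖) ∧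
    (B1 ^ 2 ≤ 2 * |B3| * (‖4 * B2 + 2 * (B3 : ℂ)‖ + 2 * |B3|) →
      ‖(B1 : ℂ) * c 1‖ - ‖B2 * (c 1) ^ 2 + (B3 : ℂ) * c 2‖
        ≤ 2 * B1 * Real.sqrt (2 * |B3| / (‖4 * B2 + 2 * (B3 : ℂ)‖ + 2 * |B3|))) ∧
    (¬ (‖4 * B2 + 2 * (B3 : ℂ)‖ + 2 * |B3| ≤ B1) →
      ¬ (B1 ^ 2 ≤ 2 * |B3| * (‖4 * B2 + 2 * (B3 : ℂ)‖ + 2 * |B3|)) →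
      ‖(B1 : ℂ) * c 1‖ - ‖B2 * (c 1) ^ 2 + (B3 : ℂ) * c 2‖
        ≤ 2 * |B3| + B1 ^ 2 / (‖4 * B2 + 2 * (B3 : ℂ)‖ + 2 * |B3|)) ∧
    -- sharpness in each regime
    (‖4 * B2 + 2 * (B3 : ℂ)‖ + 2 * |B3| ≤ B1 →
      ∃ b Q, IsCara b Q ∧
        ‖(B1 : ℂ) * b 1‖ - ‖B2 * (b 1) ^ 2 + (B3 : ℂ) * b 2‖
          = 2 * B1 - ‖4 * B2 + 2 * (B3 : ℂ)‖) ∧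
    (B1 ^ 2 ≤ 2 * |B3| * (‖4 * B2 + 2 * (B3 : ℂ)‖ + 2 * |B3|) →
      ∃ b Q, IsCara b Q ∧
        ‖(B1 : ℂ) * b 1‖ - ‖B2 * (b 1) ^ 2 + (B3 : ℂ) * b 2‖
          = 2 * B1 * Real.sqrt (2 * |B3| / (‖4 * B2 + 2 * (B3 : ℂ)‖ + 2 * |B3|))) ∧
    (¬ (‖4 * B2 + 2 * (B3 : ℂ)‖ + 2 * |B3| ≤ B1) →
      ¬ (B1 ^ 2 ≤ 2 * |B3| * (‖4 * B2 + 2 * (B3 : ℂ)‖ + 2 * |B3|)) →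
      ∃ b Q, IsCara b Q ∧
        ‖(B1 : ℂ) * b 1‖ - ‖B2 * (b 1) ^ 2 + (B3 : ℂ) * b 2‖
          = 2 * |B3| + B1 ^ 2 / (‖4 * B2 + 2 * (B3 : ℂ)‖ + 2 * |B3|)) := by
  set t := 2 * |B3| with ht
  set S := ‖4 * B2 + 2 * (B3 : ℂ)‖ + t with hS
  have ht0 : 0 ≤ t := by positivity
  have htS : t ≤ S := le_add_of_nonneg_left (norm_nonneg _)
  have hB4 : ‖4 * B2 + 2 * (B3 : ℂ)‖ = S - t := by rw [hS]; ring
  obtain ⟨x, hx0, hx1, hpsi⟩ : ∃ x : ℝ, 0 ≤ x ∧ x ≤ 1 ∧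
      ‖(B1 : ℂ) * c 1‖ - ‖B2 * (c 1) ^ 2 + (B3 : ℂ) * c 2‖
        ≤ 2 * B1 * x - max 0 (S * x ^ 2 - t) := by
    obtain ⟨h1, h2⟩ := hP.coeff_bound
    refine ⟨‖c 1 / 2‖, norm_nonneg _, h1, ?_⟩
    have e1 : ‖(B1 : ℂ) * c 1‖ = 2 * B1 * ‖c 1 / 2‖ := by
      simp [abs_of_pos hB1]; ring
    rw [e1]
    refine sub_le_sub_left (max_le (norm_nonneg _) ?_) _
    have e2 : B2 * (c 1) ^ 2 + (B3 : ℂ) * c 2 = (4 * B2 + 2 * (B3 : ℂ)) * (c 1 / 2) ^ 2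
        - (-(2 * B3 * (c 2 / 2 - (c 1 / 2) ^ 2))) := by ring
    rw [e2]
    refine le_trans ?_ (norm_sub_norm_le _ _)
    have e3 : ‖-(2 * (B3 : ℂ) * (c 2 / 2 - (c 1 / 2) ^ 2))‖
        = t * ‖c 2 / 2 - (c 1 / 2) ^ 2‖ := by
      rw [norm_neg, norm_mul, norm_mul, Complex.norm_real, Real.norm_eq_abs]; simp [ht]
    rw [e3, norm_mul, norm_pow, hB4]
    nlinarith [mul_le_mul_of_nonneg_left h2 ht0]
  have hm0 := le_max_left 0 (S * x ^ 2 - t)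
  have hm1 := le_max_right 0 (S * x ^ 2 - t)
  have hex := fun y : ℝ => exists_isCara_psi_eq hB1 B2 B3 (x := y)
  rw [← ht, ← hS] at hex
  rw [hB4]
  have hSpos2 : B1 ^ 2 ≤ t * S → 0 < S := fun h => by
    by_contra! hn
    nlinarith [pow_pos hB1 2]
  have hsq : 0 < S → Real.sqrt (t / S) ^ 2 = t / S := fun h => Real.sq_sqrt (by positivity)
  refine ⟨fun h => ?_, fun h => ?_, fun h h' => ?_, fun h => ?_, fun h => ?_, fun h h' => ?_⟩
  · nlinarith [mul_nonneg (sub_nonneg.mpr hx1) (sub_nonneg.mpr h),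
      mul_nonneg (mul_nonneg (sub_nonneg.mpr hx1) (sub_nonneg.mpr hx1)) (ht0.trans htS)]
  · have hS0 := hSpos2 h
    have hy := hsq hS0
    have hy0 := Real.sqrt_nonneg (t / S)
    set y := Real.sqrt (t / S)
    rw [eq_div_iff hS0.ne'] at hy
    rcases le_total x y with hxy | hxy
    · nlinarith [mul_le_mul_of_nonneg_left hxy hB1.le]
    · have hB : B1 ≤ S * y := by
        refine (sq_le_sq₀ hB1.le (by positivity)).mp ?_
        nlinarith
      nlinarith [mul_nonneg (sub_nonneg.mpr hxy) (sub_nonneg.mpr hB),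
        mul_nonneg (mul_nonneg (sub_nonneg.mpr hxy) (sub_nonneg.mpr hxy)) hS0.le]
  · have hS0 : 0 < S := by linarith
    have : B1 ^ 2 / S + S * x ^ 2 - 2 * B1 * x = (B1 - S * x) ^ 2 / S := by field_simp; ring
    have h2 : 0 ≤ (B1 - S * x) ^ 2 / S := by positivity
    linarith
  · obtain ⟨b, Q, hQ, hv⟩ := hex 1 zero_le_one le_rfl (by linarith)
    exact ⟨b, Q, hQ, by rw [hv]; ring⟩
  · have hS0 := hSpos2 h
    have hy : S * Real.sqrt (t / S) ^ 2 = t := by rw [hsq hS0]; field_simp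
    obtain ⟨b, Q, hQ, hv⟩ := hex (Real.sqrt (t / S)) (Real.sqrt_nonneg _)
      (Real.sqrt_le_one.mpr ((div_le_one hS0).mpr htS)) hy.ge
    exact ⟨b, Q, hQ, by rw [hv, hy]; ring⟩
  · push Not at h h'
    have hS0 : 0 < S := by linarith
    have hy : S * (B1 / S) ^ 2 = B1 ^ 2 / S := by field_simp
    obtain ⟨b, Q, hQ, hv⟩ := hex (B1 / S) (by positivity) ((div_le_one hS0).mpr h.le)
      (by rw [hy, le_div_iff₀ hS0]; exact h'.le)
    exact ⟨b, Q, hQ, by rw [hv, hy]; field_simp; ring⟩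
end
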